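/- Fix x₀ ∈ ℝ and ρ > 0, and let Ω = ℝ × (0, ρ). Let C* = {(x,y) ∈ Ω : x − x₀ − √(ρ² − y²) = 0} (a quarter of the circle of radius ρ centered at (x₀, 0)). Let P₁, P₂ ∈ C* and let X* be a regular C¹ curve in Ω from P₁ to P₂ whose image is contained in C*. Then for every C¹ curve X in Ω from P₁ to P₂ one has L_φ(X) ≥ L_φ(X*), where φ(x,y) = 1/y is the hyperbolic length density of the upper half-plane. -/

import Mathlib

open Set

/-- Euclidean norm of a vector in `ℝ × ℝ`. -/
noncomputable def elen (v : ℝ × ℝ) : ℝ := Real.sqrt (v.1 ^ 2 + v.2 ^ 2)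

/-- Euclidean dot product on `ℝ × ℝ`. -/
def dotp (v w : ℝ × ℝ) : ℝ := v.1 * w.1 + v.2 * w.2

/-- The gradient `(u_x, u_y)` of `u : ℝ × ℝ → ℝ` at a point. -/
noncomputable def grad (u : ℝ × ℝ → ℝ) (p : ℝ × ℝ) : ℝ × ℝ :=
  (fderiv ℝ u p (1, 0), fderiv ℝ u p (0, 1))

/-- A C¹ curve in `Ω` from `P₁` to `P₂`, parametrized on `[0,1]`. -/
def IsC1CurveIn (Ω : Set (ℝ × ℝ)) (P₁ P₂ : ℝ × ℝ) (X : ℝ → ℝ × ℝ) : Prop :=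
  ContDiffOn ℝ 1 X (Icc 0 1) ∧ (∀ t ∈ Icc (0:ℝ) 1, X t ∈ Ω) ∧ X 0 = P₁ ∧ X 1 = P₂

/-- Regularity: nonvanishing velocity on `[0,1]`. -/
def IsRegularCurve (X : ℝ → ℝ × ℝ) : Prop :=
  ∀ t ∈ Icc (0:ℝ) 1, derivWithin X (Icc 0 1) t ≠ 0

/-- Weighted length `∫₀¹ φ(X(t)) ‖X'(t)‖ dt` with respect to a density `φ`. -/
noncomputable def wLen (φ : ℝ × ℝ → ℝ) (X : ℝ → ℝ × ℝ) : ℝ :=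
  ∫ t in (0:ℝ)..1, φ (X t) * elen (derivWithin X (Icc 0 1) t)

/-- The `y`-part of the calibrating field. -/
noncomputable def calG (ρ y : ℝ) : ℝ := Real.sqrt (ρ ^ 2 - y ^ 2) / (ρ * y)

/-- The calibrating potential. -/
noncomputable def calF (ρ : ℝ) (p : ℝ × ℝ) : ℝ := p.1 / ρ - ∫ u in (ρ / 2)..p.2, calG ρ u

/-- The derivative of the potential along a curve. -/
noncomputable def calD (ρ : ℝ) (X : ℝ → ℝ × ℝ) (t : ℝ) : ℝ :=
  (derivWithin X (Icc 0 1) t).1 / ρ - calG ρ (X t).2 * (derivWithin X (Icc 0 1) t).2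

lemma calG_contOn (ρ : ℝ) (hρ : 0 < ρ) : ContinuousOn (calG ρ) (Ioi 0) := by
  unfold calG
  apply ContinuousOn.div (by fun_prop) (by fun_prop)
  intro y hy
  have : 0 < y := hy
  positivity

lemma calG_primitive (ρ : ℝ) (hρ : 0 < ρ) (y : ℝ) (hy : 0 < y) :
    HasDerivAt (fun y => ∫ u in (ρ / 2)..y, calG ρ u) (calG ρ y) y := by
  apply intervalIntegral.integral_hasDerivAt_right
  · apply ContinuousOn.intervalIntegrable
    apply (calG_contOn ρ hρ).mono
    intro u hu
    have h1 : min (ρ / 2) y ≤ u := hu.1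
    have : 0 < min (ρ / 2) y := lt_min (by positivity) hy
    exact lt_of_lt_of_le this h1
  · exact (calG_contOn ρ hρ).stronglyMeasurableAtFilter isOpen_Ioi y hy
  · exact (calG_contOn ρ hρ).continuousAt (Ioi_mem_nhds hy)

lemma curve_deriv {Ω : Set (ℝ × ℝ)} {P₁ P₂ : ℝ × ℝ} {X : ℝ → ℝ × ℝ}
    (hX : IsC1CurveIn Ω P₁ P₂ X) (t : ℝ) (ht : t ∈ Icc (0:ℝ) 1) :
    HasDerivWithinAt (fun t => (X t).1) (derivWithin X (Icc 0 1) t).1 (Icc 0 1) t ∧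
    HasDerivWithinAt (fun t => (X t).2) (derivWithin X (Icc 0 1) t).2 (Icc 0 1) t := by
  have h := ((hX.1.differentiableOn (by norm_num)) t ht).hasDerivWithinAt
  exact ⟨(hasFDerivAt_fst (𝕜 := ℝ) (p := X t)).comp_hasDerivWithinAt t h,
    (hasFDerivAt_snd (𝕜 := ℝ) (p := X t)).comp_hasDerivWithinAt t h⟩

lemma curve_deriv_cont {Ω : Set (ℝ × ℝ)} {P₁ P₂ : ℝ × ℝ} {X : ℝ → ℝ × ℝ}
    (hX : IsC1CurveIn Ω P₁ P₂ X) : ContinuousOn (derivWithin X (Icc 0 1)) (Icc 0 1) :=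
  hX.1.continuousOn_derivWithin (uniqueDiffOn_Icc zero_lt_one) le_rfl

lemma calD_cont (ρ : ℝ) (hρ : 0 < ρ) {P₁ P₂ : ℝ × ℝ} {X : ℝ → ℝ × ℝ}
    (hX : IsC1CurveIn ((univ : Set ℝ) ×ˢ Ioo 0 ρ) P₁ P₂ X) :
    ContinuousOn (calD ρ X) (Icc 0 1) := by
  have h1 := curve_deriv_cont hX
  have h2 : ContinuousOn (fun t => calG ρ (X t).2) (Icc 0 1) :=
    (calG_contOn ρ hρ).comp (continuous_snd.comp_continuousOn hX.1.continuousOn)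
      (fun t ht => (hX.2.1 t ht).2.1)
  unfold calD
  exact (h1.fst.div_const ρ).sub (h2.mul h1.snd)

lemma calD_integral (ρ : ℝ) (hρ : 0 < ρ) {P₁ P₂ : ℝ × ℝ} {X : ℝ → ℝ × ℝ}
    (hX : IsC1CurveIn ((univ : Set ℝ) ×ˢ Ioo 0 ρ) P₁ P₂ X) :
    ∫ t in (0:ℝ)..1, calD ρ X t = calF ρ P₂ - calF ρ P₁ := by
  have hd : ∀ t ∈ Icc (0:ℝ) 1,
      HasDerivWithinAt (fun t => calF ρ (X t)) (calD ρ X t) (Icc 0 1) t := by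
    intro t ht
    obtain ⟨h1, h2⟩ := curve_deriv hX t ht
    have h3 := (calG_primitive ρ hρ (X t).2 (hX.2.1 t ht).2.1).comp_hasDerivWithinAt t h2
    exact (h1.div_const ρ).sub h3
  have := intervalIntegral.integral_eq_sub_of_hasDerivAt_of_le (zero_le_one' ℝ)
    (f := fun t => calF ρ (X t)) (f' := calD ρ X)
    (fun t ht => (hd t ht).continuousWithinAt)
    (fun t ht => (hd t (Ioo_subset_Icc_self ht)).hasDerivAt (Icc_mem_nhds ht.1 ht.2))
    ((calD_cont ρ hρ hX).intervalIntegrable_of_Icc zero_le_one)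
  rw [this, hX.2.2.1, hX.2.2.2]

lemma calD_sq (ρ : ℝ) (hρ : 0 < ρ) {X : ℝ → ℝ × ℝ} {t : ℝ} (h : (X t).2 ∈ Ioo 0 ρ) :
    (1 / (X t).2 * elen (derivWithin X (Icc 0 1) t)) ^ 2 = calD ρ X t ^ 2 +
      ((Real.sqrt (ρ ^ 2 - (X t).2 ^ 2) * (derivWithin X (Icc 0 1) t).1
        + (X t).2 * (derivWithin X (Icc 0 1) t).2) / (ρ * (X t).2)) ^ 2 := by
  have hy := h.1
  have hs : Real.sqrt (ρ ^ 2 - (X t).2 ^ 2) ^ 2 = ρ ^ 2 - (X t).2 ^ 2 :=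
    Real.sq_sqrt (by nlinarith [h.1, h.2])
  unfold calD calG elen
  rw [mul_pow, Real.sq_sqrt (by positivity)]
  generalize Real.sqrt (ρ ^ 2 - (X t).2 ^ 2) = s at *
  generalize (X t).2 = y at *
  generalize (derivWithin X (Icc 0 1) t).1 = a
  generalize (derivWithin X (Icc 0 1) t).2 = b
  field_simp
  linear_combination (-(a ^ 2 + b ^ 2)) * hs

lemma len_nonneg (ρ : ℝ) {X : ℝ → ℝ × ℝ} {t : ℝ} (h : (X t).2 ∈ Ioo 0 ρ) :
    0 ≤ 1 / (X t).2 * elen (derivWithin X (Icc 0 1) t) :=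
  mul_nonneg (one_div_nonneg.2 h.1.le) (Real.sqrt_nonneg _)

lemma len_ge (ρ : ℝ) (hρ : 0 < ρ) {P₁ P₂ : ℝ × ℝ} {X : ℝ → ℝ × ℝ}
    (hX : IsC1CurveIn ((univ : Set ℝ) ×ˢ Ioo 0 ρ) P₁ P₂ X) :
    |calF ρ P₂ - calF ρ P₁| ≤ wLen (fun p => 1 / p.2) X := by
  rw [← calD_integral ρ hρ hX]
  have hc : ContinuousOn (fun t => 1 / (X t).2 * elen (derivWithin X (Icc 0 1) t)) (Icc 0 1) := by
    have h1 := curve_deriv_cont hX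
    have h2 := hX.1.continuousOn.snd
    refine (continuousOn_const.div h2 (fun t ht => (hX.2.1 t ht).2.1.ne')).mul ?_
    exact ((h1.fst.pow 2).add (h1.snd.pow 2)).sqrt
  refine (intervalIntegral.abs_integral_le_integral_abs zero_le_one).trans ?_
  apply intervalIntegral.integral_mono_on zero_le_one
  · exact (calD_cont ρ hρ hX).abs.intervalIntegrable_of_Icc zero_le_one
  · exact hc.intervalIntegrable_of_Icc zero_le_one
  · intro t ht
    have h := (hX.2.1 t ht).2
    apply abs_le_of_sq_le_sq _ (len_nonneg ρ h)
    rw [calD_sq ρ hρ h]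
    exact le_add_of_nonneg_right (sq_nonneg _)

lemma len_star (x₀ ρ : ℝ) (hρ : 0 < ρ) {P₁ P₂ : ℝ × ℝ} {X : ℝ → ℝ × ℝ}
    (hX : IsC1CurveIn ((univ : Set ℝ) ×ˢ Ioo 0 ρ) P₁ P₂ X) (hreg : IsRegularCurve X)
    (hlevel : ∀ t ∈ Icc (0:ℝ) 1, (X t).1 - x₀ - Real.sqrt (ρ ^ 2 - (X t).2 ^ 2) = 0) :
    wLen (fun p => 1 / p.2) X = |calF ρ P₂ - calF ρ P₁| := by
  have key : ∀ t ∈ Icc (0:ℝ) 1,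
      1 / (X t).2 * elen (derivWithin X (Icc 0 1) t) = |calD ρ X t| := by
    intro t ht
    have h := (hX.2.1 t ht).2
    obtain ⟨h1, h2⟩ := curve_deriv hX t ht
    have hcirc : ∀ u ∈ Icc (0:ℝ) 1, ((X u).1 - x₀) ^ 2 + (X u).2 ^ 2 = ρ ^ 2 := by
      intro u hu
      have h := (hX.2.1 u hu).2
      have hs : Real.sqrt (ρ ^ 2 - (X u).2 ^ 2) ^ 2 = ρ ^ 2 - (X u).2 ^ 2 :=
        Real.sq_sqrt (by nlinarith [h.1, h.2])
      rw [sub_eq_zero.1 (hlevel u hu), hs]; ring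
    have hA := ((h1.sub_const x₀).pow 2).add (h2.pow 2)
    have hB := (hasDerivWithinAt_const t (Icc (0:ℝ) 1) (ρ ^ 2)).congr hcirc (hcirc t ht)
    have hE := (uniqueDiffOn_Icc (zero_lt_one' ℝ) t ht).eq_deriv _ hA hB
    have hs := sub_eq_zero.1 (hlevel t ht)
    have hz : Real.sqrt (ρ ^ 2 - (X t).2 ^ 2) * (derivWithin X (Icc 0 1) t).1
        + (X t).2 * (derivWithin X (Icc 0 1) t).2 = 0 := by
      rw [← hs]
      norm_num at hE
      linarith
    have hq := calD_sq ρ hρ h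
    rw [hz] at hq
    rw [← abs_of_nonneg (len_nonneg ρ h)]
    apply (sq_eq_sq_iff_abs_eq_abs _ _).1
    rw [hq]; ring
  have hne : ∀ t ∈ Icc (0:ℝ) 1, calD ρ X t ≠ 0 := by
    intro t ht h0
    have hk := key t ht
    have hy := (hX.2.1 t ht).2.1
    rw [h0, abs_zero, mul_eq_zero] at hk
    rcases hk with hk | hk
    · exact (one_div_pos.2 hy).ne' hk
    · unfold elen at hk
      rw [Real.sqrt_eq_zero (by positivity)] at hk
      apply hreg t ht
      ext
      · simp only [Prod.fst_zero]; nlinarith [sq_nonneg (derivWithin X (Icc 0 1) t).1, sq_nonneg (derivWithin X (Icc 0 1) t).2]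
      · simp only [Prod.snd_zero]; nlinarith [sq_nonneg (derivWithin X (Icc 0 1) t).1, sq_nonneg (derivWithin X (Icc 0 1) t).2]
  have hL : wLen (fun p => 1 / p.2) X = ∫ t in (0:ℝ)..1, |calD ρ X t| := by
    apply intervalIntegral.integral_congr
    intro t ht
    rw [uIcc_of_le zero_le_one] at ht
    exact key t ht
  rw [hL, ← calD_integral ρ hρ hX]
  have hc := calD_cont ρ hρ hX
  have hsign : (∀ t ∈ Icc (0:ℝ) 1, 0 ≤ calD ρ X t) ∨ (∀ t ∈ Icc (0:ℝ) 1, calD ρ X t ≤ 0) := by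
    by_contra hcon
    push Not at hcon
    obtain ⟨⟨a, ha, ha'⟩, b, hb, hb'⟩ := hcon
    obtain ⟨c, hcm, hc0⟩ := isPreconnected_Icc.intermediate_value ha hb hc ⟨ha'.le, hb'.le⟩
    exact hne c hcm hc0
  rcases hsign with hs | hs
  · rw [abs_of_nonneg (intervalIntegral.integral_nonneg zero_le_one hs)]
    apply intervalIntegral.integral_congr
    intro t ht
    rw [uIcc_of_le zero_le_one] at ht
    exact abs_of_nonneg (hs t ht)
  · have h1 : ∫ t in (0:ℝ)..1, |calD ρ X t| = ∫ t in (0:ℝ)..1, -calD ρ X t := by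
      apply intervalIntegral.integral_congr
      intro t ht
      rw [uIcc_of_le zero_le_one] at ht
      exact abs_of_nonpos (hs t ht)
    have h2 : 0 ≤ ∫ t in (0:ℝ)..1, -calD ρ X t :=
      intervalIntegral.integral_nonneg zero_le_one (fun t ht => neg_nonneg.2 (hs t ht))
    rw [h1]
    rw [intervalIntegral.integral_neg] at h2 ⊢
    exact (abs_of_nonpos (neg_nonneg.1 h2)).symm

/-- the quarter circle `x − x₀ − √(ρ² − y²) = 0` in the strip
`ℝ × (0, ρ)` is a weighted length-minimizer for the hyperbolic density `1/y`. -/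
theorem statement10 (x₀ ρ : ℝ) (hρ : 0 < ρ) (P₁ P₂ : ℝ × ℝ)
    (hP₁ : P₁ ∈ (univ : Set ℝ) ×ˢ Ioo 0 ρ)
    (hP₁' : P₁.1 - x₀ - Real.sqrt (ρ ^ 2 - P₁.2 ^ 2) = 0)
    (hP₂ : P₂ ∈ (univ : Set ℝ) ×ˢ Ioo 0 ρ)
    (hP₂' : P₂.1 - x₀ - Real.sqrt (ρ ^ 2 - P₂.2 ^ 2) = 0)
    (Xstar : ℝ → ℝ × ℝ)
    (hXstar : IsC1CurveIn ((univ : Set ℝ) ×ˢ Ioo 0 ρ) P₁ P₂ Xstar)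
    (hreg : IsRegularCurve Xstar)
    (hlevel : ∀ t ∈ Icc (0:ℝ) 1,
      (Xstar t).1 - x₀ - Real.sqrt (ρ ^ 2 - (Xstar t).2 ^ 2) = 0)
    (X : ℝ → ℝ × ℝ) (hX : IsC1CurveIn ((univ : Set ℝ) ×ˢ Ioo 0 ρ) P₁ P₂ X) :
    wLen (fun p => 1 / p.2) X ≥ wLen (fun p => 1 / p.2) Xstar := by
  rw [len_star x₀ ρ hρ hXstar hreg hlevel]
  exact len_ge ρ hρ hX
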